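/- arXiv:1402.5904 — 2 statements merged into one kernel-verified Lean document; each statement's English description precedes it below -/
import Mathlib

section
/- Let n ≥ 3 be a natural number and let d ≥ 4 be a real number. Then the integrality ratio of the subtour LP for the instance G(n,d) is at least (4n + 2d − 2 − 2n/(d+1)) / (3n + 4d). -/
open Real Filter Finset

noncomputable section

/-- Euclidean distance between two points of the plane. -/
def eucl (p q : ℝ × ℝ) : ℝ := Real.sqrt ((p.1 - q.1) ^ 2 + (p.2 - q.2) ^ 2)

/-- The points of the Euclidean TSP instance `G(n,d)`: the `3n` points
`(i, j·d)` for `i = 1,…,n` and `j = 1,2,3`, indexed by `Fin n × Fin 3`. -/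
def pt (n : ℕ) (d : ℝ) (p : Fin n × Fin 3) : ℝ × ℝ :=
  ((p.1.val : ℝ) + 1, ((p.2.val : ℝ) + 1) * d)

/-- A TSP tour of `G(n,d)`: a cyclic listing of all `3n` points (a Hamiltonian
cycle), given as a sequence `t` that hits every point exactly once in
positions `0,…,3n−1` and returns to its start at position `3n`. -/
def IsTour (n : ℕ) (t : ℕ → Fin n × Fin 3) : Prop :=
  Function.Bijective (fun i : Fin (3 * n) => t i) ∧ t (3 * n) = t 0

/-- The length of a TSP tour: the sum of the Euclidean distances between
consecutive points of the cycle. -/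
def tourLength (n : ℕ) (d : ℝ) (t : ℕ → Fin n × Fin 3) : ℝ :=
  ∑ i ∈ Finset.range (3 * n), eucl (pt n d (t i)) (pt n d (t (i + 1)))

/-- Feasibility for the subtour LP on the points of `G(n,d)`, with symmetric
edge variables `x i j`: degree constraints `∑_{j≠i} x i j = 2`, subtour
elimination constraints (each unordered pair is counted twice in the double
sum, whence the factor 2), and `0 ≤ x i j ≤ 1`. -/
def SubtourLPFeasible (n : ℕ) (x : Fin n × Fin 3 → Fin n × Fin 3 → ℝ) : Prop :=
  (∀ i j, x i j = x j i) ∧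
  (∀ i, x i i = 0) ∧
  (∀ i j, 0 ≤ x i j ∧ x i j ≤ 1) ∧
  (∀ i, ∑ j, x i j = 2) ∧
  (∀ S : Finset (Fin n × Fin 3), S.Nonempty → S ≠ Finset.univ →
      ∑ i ∈ S, ∑ j ∈ S, x i j ≤ 2 * ((S.card : ℝ) - 1))

/-- The objective value of the subtour LP for `G(n,d)`: each unordered pair
appears twice in the double sum, whence the factor `1/2`. -/
def lpValue (n : ℕ) (d : ℝ) (x : Fin n × Fin 3 → Fin n × Fin 3 → ℝ) : ℝ :=
  (1 / 2) * ∑ i, ∑ j, eucl (pt n d i) (pt n d j) * x i j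

/-- The length of a shortest TSP tour of `G(n,d)`. -/
def optTour (n : ℕ) (d : ℝ) : ℝ :=
  sInf {L | ∃ t, IsTour n t ∧ tourLength n d t = L}

/-- The optimum value of the subtour LP for `G(n,d)`. -/
def optLP (n : ℕ) (d : ℝ) : ℝ :=
  sInf {L | ∃ x, SubtourLPFeasible n x ∧ lpValue n d x = L}

/-- `zcost d z` is the length of a z-shaped path covering `z` points in the
middle row of `G(n,d)`. -/
def zcost (d x : ℝ) : ℝ := 2 * (x - 1) + Real.sqrt ((x - 1) ^ 2 + d ^ 2)

/-- The excess of a segment with horizontal extent `w` and vertical extent `d` over `w`. -/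
def diagGain (d : ℝ) (w : ℕ) : ℝ := Real.sqrt ((w : ℝ) ^ 2 + d ^ 2) - w

lemma diagGain_nonneg (d : ℝ) (w : ℕ) : 0 ≤ diagGain d w :=
  sub_nonneg.2 (Real.le_sqrt_of_sq_le (by nlinarith [sq_nonneg d]))

lemma diagGain_antitone (d : ℝ) : Antitone (diagGain d) := by
  intro v w h
  have hvw : (v : ℝ) ≤ w := by exact_mod_cast h
  have hs := Real.sq_sqrt (by positivity : (0 : ℝ) ≤ (v : ℝ) ^ 2 + d ^ 2)
  have hv : (v : ℝ) ≤ Real.sqrt ((v : ℝ) ^ 2 + d ^ 2) := by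
    have := diagGain_nonneg d v
    unfold diagGain at this
    linarith
  have : Real.sqrt ((w : ℝ) ^ 2 + d ^ 2) ≤ Real.sqrt ((v : ℝ) ^ 2 + d ^ 2) + (w - v) := by
    refine Real.sqrt_le_iff.2 ⟨by linarith [Real.sqrt_nonneg ((v : ℝ) ^ 2 + d ^ 2)], ?_⟩
    nlinarith
  unfold diagGain
  linarith

lemma le_diagGain_add (d : ℝ) (w : ℕ) : d ≤ diagGain d w + w := by
  unfold diagGain
  have : d ≤ Real.sqrt ((w : ℝ) ^ 2 + d ^ 2) :=
    Real.le_sqrt_of_sq_le (by nlinarith [sq_nonneg (w : ℝ)])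
  linarith

lemma two_sub_le_diagGain {d : ℝ} (hd : 1 ≤ d) (w : ℕ) :
    2 - 2 * ((w : ℝ) + 1) / (d + 1) ≤ diagGain d w := by
  have hpos : 0 < d + 1 := by linarith
  have key : (w * (d - 1) + 2 * d) / (d + 1) ≤ Real.sqrt ((w : ℝ) ^ 2 + d ^ 2) := by
    apply Real.le_sqrt_of_sq_le
    rw [div_pow, div_le_iff₀ (by positivity)]
    have h1 : 0 ≤ d * (2 * (w : ℝ) - (d - 1)) ^ 2 := by positivity
    have h2 : 0 ≤ d * (d - 1) * (d ^ 2 + 2 * d + 1) :=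
      mul_nonneg (mul_nonneg (by linarith) (by linarith)) (by positivity)
    nlinarith
  have : 2 - 2 * ((w : ℝ) + 1) / (d + 1) = (w * (d - 1) + 2 * d) / (d + 1) - w := by
    field_simp
    ring
  unfold diagGain
  linarith

section Intervals

variable {ι : Type*} (E : Finset ι) (l r : ι → ℕ) (c : ℕ → ℕ) (d : ℝ)

/-- The members of a family of intervals `[l e, r e]` contained in `[a, b)`. -/
def innerEdges (a b : ℕ) : Finset ι := E.filter fun e => a ≤ l e ∧ r e < b

/-- The total length attributed to the columns in `[a, b)`, where the line to the left of column
`k` is crossed `2 * c k` times and the row-changing edges are `E`. -/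
def blockCost (a b : ℕ) : ℝ :=
  2 * ∑ k ∈ Finset.Ioo a b, (c k : ℝ) + ∑ e ∈ innerEdges E l r a b, diagGain d (r e - l e)

variable {E l r c d}

lemma innerEdges_mono {a a' b b' : ℕ} (ha : a ≤ a') (hb : b' ≤ b) :
    innerEdges E l r a' b' ⊆ innerEdges E l r a b := by
  intro e he
  simp only [innerEdges, Finset.mem_filter] at he ⊢
  exact ⟨he.1, by omega, by omega⟩

lemma diagGain_le_of_mem_innerEdges {a b : ℕ} {e : ι} (he : e ∈ innerEdges E l r a b) :
    diagGain d (b - a - 1) ≤ diagGain d (r e - l e) := by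
  simp only [innerEdges, Finset.mem_filter] at he
  exact diagGain_antitone d (by omega)

lemma sum_Ioo_split {a k b : ℕ} (hak : a < k) (hkb : k < b) :
    ∑ j ∈ Finset.Ioo a b, (c j : ℝ) =
      ∑ j ∈ Finset.Ioo a k, (c j : ℝ) + c k + ∑ j ∈ Finset.Ioo k b, (c j : ℝ) := by
  have h : Finset.Ioo a b = insert k (Finset.Ioo a k ∪ Finset.Ioo k b) := by
    ext j
    simp only [Finset.mem_Ioo, Finset.mem_insert, Finset.mem_union]
    omega
  rw [h, Finset.sum_insert (by simp), Finset.sum_union]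
  · ring
  · rw [Finset.disjoint_left]
    intro j hj hj'
    simp only [Finset.mem_Ioo] at hj hj'
    omega

lemma mul_le_sum_Ioo {a b m : ℕ} (hab : a < b) (h : ∀ k, a < k → k < b → m ≤ c k) :
    (m : ℝ) * ((b : ℝ) - a - 1) ≤ ∑ k ∈ Finset.Ioo a b, (c k : ℝ) := by
  have h1 : (m : ℝ) * ((b : ℝ) - a - 1) = ∑ _k ∈ Finset.Ioo a b, (m : ℝ) := by
    rw [Finset.sum_const, Nat.card_Ioo, nsmul_eq_mul, Nat.sub_sub, Nat.cast_sub (by omega)]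
    push_cast
    ring
  rw [h1]
  refine Finset.sum_le_sum fun k hk => ?_
  rw [Finset.mem_Ioo] at hk
  exact_mod_cast h k hk.1 hk.2

lemma sum_diagGain_le {a b : ℕ} {s : Finset ι} (hs : s ⊆ innerEdges E l r a b) :
    ∑ e ∈ s, diagGain d (r e - l e) ≤ ∑ e ∈ innerEdges E l r a b, diagGain d (r e - l e) :=
  Finset.sum_le_sum_of_subset_of_nonneg hs fun _ _ _ => diagGain_nonneg _ _

lemma blockCost_add_le [DecidableEq ι] {a k b : ℕ} (hlr : ∀ e, l e ≤ r e) (hak : a < k)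
    (hkb : k < b) :
    blockCost E l r c d a k + 2 * c k + blockCost E l r c d k b ≤ blockCost E l r c d a b := by
  unfold blockCost
  have hdisj : Disjoint (innerEdges E l r a k) (innerEdges E l r k b) := by
    rw [Finset.disjoint_left]
    intro e he he'
    simp only [innerEdges, Finset.mem_filter] at he he'
    have := hlr e
    omega
  have h := sum_diagGain_le (d := d) (Finset.union_subset
    (innerEdges_mono (E := E) (l := l) (r := r) le_rfl hkb.le) (innerEdges_mono hak.le le_rfl))
  rw [Finset.sum_union hdisj] at h
  rw [sum_Ioo_split hak hkb]
  linarith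

lemma diagGain_add_le_sum [DecidableEq ι] {a a' b' b : ℕ} (ha : a ≤ a') (hb : b' ≤ b)
    (h1 : 1 ≤ (innerEdges E l r a' b').card) (h2 : 2 ≤ (innerEdges E l r a b).card) :
    diagGain d (b' - a' - 1) + diagGain d (b - a - 1) ≤
      ∑ e ∈ innerEdges E l r a b, diagGain d (r e - l e) := by
  obtain ⟨e₁, he₁⟩ := Finset.card_pos.1 h1
  obtain ⟨e₂, he₂, hne⟩ := Finset.exists_mem_ne h2 e₁
  have h := sum_diagGain_le (d := d) (s := {e₁, e₂}) (a := a) (b := b) (E := E) (l := l) (r := r)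
    (by
      intro e he
      simp only [Finset.mem_insert, Finset.mem_singleton] at he
      rcases he with rfl | rfl
      · exact innerEdges_mono ha hb he₁
      · exact he₂)
  rw [Finset.sum_pair hne.symm] at h
  linarith [diagGain_le_of_mem_innerEdges (d := d) he₁, diagGain_le_of_mem_innerEdges (d := d) he₂]

lemma le_blockCost_left [DecidableEq ι] (hd : 1 ≤ d) {b : ℕ} (hb : 0 < b) (hcb : c b = 1)
    (hc : ∀ k, 0 < k → k < b → 2 ≤ c k)
    (hE : ∀ k, 0 < k → k ≤ b → 3 ≤ (innerEdges E l r 0 k).card + c k) :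
    4 * ((b : ℝ) - 1) + d + 2 - 2 * b / (d + 1) ≤ blockCost E l r c d 0 b := by
  classical
  have hex : ∃ k, 0 < k ∧ k ≤ b ∧ c k ≤ 2 := ⟨b, hb, le_rfl, by omega⟩
  obtain ⟨hk0, hkb, hck⟩ := Nat.find_spec hex
  have hmin : ∀ j, 0 < j → j < Nat.find hex → 3 ≤ c j := fun j hj hjk => by
    have := Nat.find_min hex hjk
    by_contra hcon
    exact this ⟨hj, by omega, by omega⟩
  set k := Nat.find hex
  have hgain := diagGain_add_le_sum (d := d) (E := E) (l := l) (r := r) (le_refl 0) hkb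
    (by have := hE k hk0 hkb; omega) (by have := hE b hb le_rfl; omega)
  have hsum : 3 * ((k : ℝ) - 1) + 2 * ((b : ℝ) - k) ≤ ∑ j ∈ Finset.Ioo 0 b, (c j : ℝ) := by
    have h1 := mul_le_sum_Ioo hk0 hmin
    rcases hkb.eq_or_lt with h | h
    · rw [← h]
      push_cast at h1
      linarith
    · rw [sum_Ioo_split hk0 h]
      have h2 := mul_le_sum_Ioo h (m := 2) fun j hj hjb => hc j (by omega) hjb
      have h3 : (2 : ℝ) ≤ c k := by exact_mod_cast hc k hk0 h
      push_cast at h1 h2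
      linarith
  have g1 := le_diagGain_add d (k - 0 - 1)
  have g2 := two_sub_le_diagGain hd (b - 0 - 1)
  have hk1 : ((k - 0 - 1 : ℕ) : ℝ) = k - 1 := by
    rw [Nat.sub_zero, Nat.cast_sub hk0]; simp
  have hb1 : ((b - 0 - 1 : ℕ) : ℝ) = b - 1 := by
    rw [Nat.sub_zero, Nat.cast_sub hb]; simp
  rw [hk1] at g1
  rw [hb1, sub_add_cancel] at g2
  have : (1 : ℝ) ≤ k := by exact_mod_cast hk0
  unfold blockCost
  linarith

lemma blockCost_reflect {n a : ℕ} (ha : a < n) (hlr : ∀ e, l e ≤ r e) (hr : ∀ e, r e < n) :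
    blockCost E (fun e => n - 1 - r e) (fun e => n - 1 - l e) (fun k => c (n - k)) d 0 (n - a) =
      blockCost E l r c d a n := by
  unfold blockCost
  have hinner : innerEdges E (fun e => n - 1 - r e) (fun e => n - 1 - l e) 0 (n - a) =
      innerEdges E l r a n := by
    refine Finset.filter_congr fun e _ => ?_
    have := hlr e
    have := hr e
    dsimp only
    omega
  rw [hinner]
  congr 1
  · congr 1
    refine Finset.sum_bij' (fun k _ => n - k) (fun k _ => n - k) ?_ ?_ ?_ ?_ ?_ <;>
      simp only [Finset.mem_Ioo] <;> grind
  · refine Finset.sum_congr rfl fun e _ => ?_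
    have := hlr e
    have := hr e
    congr 1
    dsimp only
    omega

lemma le_blockCost_right [DecidableEq ι] (hd : 1 ≤ d) {n a : ℕ} (ha : a < n) (hca : c a = 1)
    (hlr : ∀ e, l e ≤ r e) (hr : ∀ e, r e < n) (hc : ∀ k, a < k → k < n → 2 ≤ c k)
    (hE : ∀ k, a ≤ k → k < n → 3 ≤ (innerEdges E l r k n).card + c k) :
    4 * ((n : ℝ) - a - 1) + d + 2 - 2 * ((n : ℝ) - a) / (d + 1) ≤ blockCost E l r c d a n := by
  rw [← blockCost_reflect ha hlr hr, ← Nat.cast_sub ha.le]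
  refine le_blockCost_left hd (by omega) ?_ (fun k hk hk' => hc _ (by omega) (by omega)) ?_
  · rw [Nat.sub_sub_self ha.le, hca]
  · intro k hk hk'
    have hinner : innerEdges E (fun e => n - 1 - r e) (fun e => n - 1 - l e) 0 k =
        innerEdges E l r (n - k) n := by
      refine Finset.filter_congr fun e _ => ?_
      have := hlr e
      have := hr e
      dsimp only
      omega
    rw [hinner]
    exact hE _ (by omega) (by omega)

lemma le_blockCost_of_eq_one [DecidableEq ι] (hd : 1 ≤ d) (hlr : ∀ e, l e ≤ r e) {n : ℕ}
    (hc0 : c 0 = 0) (hc : ∀ k, 0 < k → k < n → 1 ≤ c k)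
    (hE : ∀ a b, a < b → b ≤ n → 3 ≤ (innerEdges E l r a b).card + c a + c b) (b : ℕ)
    (hb : 0 < b) (hbn : b < n) (hcb : c b = 1) :
    4 * ((b : ℝ) - 1) + d + 2 - 2 * b / (d + 1) ≤ blockCost E l r c d 0 b := by
  induction b using Nat.strong_induction_on with
  | _ b ih =>
    by_cases hex : ∃ a, 0 < a ∧ a < b ∧ c a = 1
    · obtain ⟨a, ⟨ha, hab, hca⟩, hmax⟩ : ∃ a, (0 < a ∧ a < b ∧ c a = 1) ∧
          ∀ k, a < k → k < b → 2 ≤ c k := by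
        obtain ⟨a, ha, hmax⟩ := Finset.exists_max_image
          ((Finset.Ioo 0 b).filter fun k => c k = 1) id (by
            obtain ⟨a, h1, h2, h3⟩ := hex
            exact ⟨a, by simp [h1, h2, h3]⟩)
        simp only [Finset.mem_filter, Finset.mem_Ioo, id] at ha hmax
        refine ⟨a, ⟨ha.1.1, ha.1.2, ha.2⟩, fun k hk hkb => ?_⟩
        have h1 := hc k (by omega) (by omega)
        by_contra hcon
        have := hmax k ⟨⟨by omega, hkb⟩, by omega⟩
        omega
      have hleft := ih a hab ha (by omega) hca
      have hadd := blockCost_add_le (E := E) (c := c) (d := d) hlr ha hab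
      have hmid : 4 * ((b : ℝ) - a - 1) + (2 - 2 * ((b : ℝ) - a) / (d + 1)) ≤
          blockCost E l r c d a b := by
        have hsum := mul_le_sum_Ioo hab hmax
        obtain ⟨e, he⟩ := Finset.card_pos.1
          (show 0 < (innerEdges E l r a b).card by have := hE a b hab hbn.le; omega)
        have h1 := Finset.single_le_sum (f := fun e => diagGain d (r e - l e))
          (fun _ _ => diagGain_nonneg _ _) he
        have h2 := diagGain_le_of_mem_innerEdges (d := d) he
        have h3 := two_sub_le_diagGain hd (b - a - 1)
        rw [Nat.sub_sub, Nat.cast_sub (by omega)] at h3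
        rw [Nat.sub_sub] at h2
        push_cast at h3 hsum
        have h4 : (b : ℝ) - (a + 1) + 1 = b - a := by ring
        rw [h4] at h3
        unfold blockCost
        linarith
      rw [hca] at hadd
      push_cast at hadd
      have : 2 * (b : ℝ) / (d + 1) = 2 * a / (d + 1) + 2 * ((b : ℝ) - a) / (d + 1) := by ring
      linarith
    · refine le_blockCost_left hd hb hcb (fun k hk hkb => ?_) fun k hk hkb => ?_
      · have := hc k hk (by omega)
        by_contra hcon
        exact hex ⟨k, hk, hkb, by omega⟩
      · have := hE 0 k hk (by omega)
        omega

lemma le_blockCost_of_two_le [DecidableEq ι] (hd : 1 ≤ d) (hlr : ∀ e, l e ≤ r e) {n : ℕ}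
    (hn : 0 < n) (hc0 : c 0 = 0) (hcn : c n = 0) (hc : ∀ k, 0 < k → k < n → 2 ≤ c k)
    (hE : ∀ a b, a < b → b ≤ n → 3 ≤ (innerEdges E l r a b).card + c a + c b) :
    4 * (n : ℝ) + 2 * d - 2 - 2 * n / (d + 1) ≤ blockCost E l r c d 0 n := by
  have hcard : 3 ≤ (innerEdges E l r 0 n).card := by have := hE 0 n hn le_rfl; omega
  have hgain := two_sub_le_diagGain hd (n - 0 - 1)
  have hn1 : ((n - 0 - 1 : ℕ) : ℝ) = n - 1 := by
    rw [Nat.sub_zero, Nat.cast_sub hn]; simp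
  rw [hn1, sub_add_cancel] at hgain
  have hn' : (1 : ℝ) ≤ n := by exact_mod_cast hn
  set A := (Finset.Ioo 0 n).filter fun k => c k ≤ 2 with hA
  unfold blockCost
  rcases A.eq_empty_or_nonempty with hempty | hne
  · have hsum := mul_le_sum_Ioo (c := c) (m := 3) hn fun k hk hkn => by
      by_contra hcon
      have : k ∈ A := by simp only [hA, Finset.mem_filter, Finset.mem_Ioo]; omega
      simp [hempty] at this
    have h1 := Finset.card_nsmul_le_sum (innerEdges E l r 0 n)
      (fun e => diagGain d (r e - l e)) _ fun e he => diagGain_le_of_mem_innerEdges (d := d) he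
    rw [nsmul_eq_mul] at h1
    have h2 : (3 : ℝ) ≤ (innerEdges E l r 0 n).card := by exact_mod_cast hcard
    have h3 := mul_le_mul_of_nonneg_right h2 (diagGain_nonneg d (n - 0 - 1))
    have h4 := le_diagGain_add d (n - 0 - 1)
    rw [hn1] at h4
    push_cast at hsum
    linarith
  · obtain ⟨a, ha, hamin⟩ := Finset.exists_min_image A id hne
    obtain ⟨b, hb, hbmax⟩ := Finset.exists_max_image A id hne
    have hab : a ≤ b := hamin b hb
    simp only [hA, Finset.mem_filter, Finset.mem_Ioo, id] at ha hb hamin hbmax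
    obtain ⟨e₁, he₁⟩ := Finset.card_pos.1
      (show 0 < (innerEdges E l r 0 a).card by have := hE 0 a (by omega) (by omega); omega)
    obtain ⟨e₂, he₂⟩ := Finset.card_pos.1
      (show 0 < (innerEdges E l r b n).card by have := hE b n (by omega) (by omega); omega)
    have hne : e₁ ≠ e₂ := by
      rintro rfl
      simp only [innerEdges, Finset.mem_filter] at he₁ he₂
      have := hlr e₁
      omega
    obtain ⟨e₃, he₃, hne₃⟩ : ∃ e ∈ innerEdges E l r 0 n, e ∉ ({e₁, e₂} : Finset ι) :=
      Finset.exists_mem_notMem_of_card_lt_card (by rw [Finset.card_pair hne]; omega)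
    simp only [Finset.mem_insert, Finset.mem_singleton, not_or] at hne₃
    have hthree := sum_diagGain_le (d := d) (s := {e₁, e₂, e₃}) (a := 0) (b := n) (E := E)
      (l := l) (r := r) (by
        intro e he
        simp only [Finset.mem_insert, Finset.mem_singleton] at he
        rcases he with rfl | rfl | rfl
        · exact innerEdges_mono le_rfl (by omega) he₁
        · exact innerEdges_mono (by omega) le_rfl he₂
        · exact he₃)
    rw [Finset.sum_insert (by simp [hne, Ne.symm hne₃.1]), Finset.sum_pair (Ne.symm hne₃.2)]
      at hthree
    have h1 := diagGain_le_of_mem_innerEdges (d := d) he₁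
    have h2 := diagGain_le_of_mem_innerEdges (d := d) he₂
    have h3 := diagGain_le_of_mem_innerEdges (d := d) he₃
    have g1 := le_diagGain_add d (a - 0 - 1)
    have g2 := le_diagGain_add d (n - b - 1)
    rw [Nat.sub_zero, Nat.cast_sub (by omega)] at g1
    rw [Nat.sub_zero] at h1
    rw [Nat.sub_sub, Nat.cast_sub (by omega)] at g2
    rw [Nat.sub_sub] at h2
    push_cast at g1 g2
    have hsum : 2 * ((n : ℝ) - 1) + ((a : ℝ) - 1) + ((n : ℝ) - b - 1) ≤
        ∑ k ∈ Finset.Ioo 0 n, (c k : ℝ) := by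
      have s1 := mul_le_sum_Ioo (c := c) (m := 3) (show 0 < a by omega) fun k hk hka => by
        by_contra hcon
        have := hamin k (by omega)
        omega
      have s2 := mul_le_sum_Ioo (c := c) (m := 3) (show b < n by omega) fun k hk hka => by
        by_contra hcon
        have := hbmax k (by omega)
        omega
      have ca : (2 : ℝ) ≤ c a := by exact_mod_cast hc a (by omega) (by omega)
      have cb : (2 : ℝ) ≤ c b := by exact_mod_cast hc b (by omega) (by omega)
      rw [sum_Ioo_split (show 0 < a by omega) (show a < n by omega)]
      push_cast at s1 s2
      rcases hab.eq_or_lt with rfl | hlt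
      · linarith
      · rw [sum_Ioo_split hlt (show b < n by omega)]
        have s3 := mul_le_sum_Ioo (c := c) (m := 2) hlt
          fun k hk hkb => hc k (by omega) (by omega)
        push_cast at s3
        linarith
    have ha1 : (1 : ℝ) ≤ a := by exact_mod_cast ha.1.1
    have hb1 : (b : ℝ) + 1 ≤ n := by exact_mod_cast hb.1.2
    linarith

/-- The combinatorial core: intervals and crossing numbers subject to the counting constraint
`hE` have total cost at least the claimed bound. -/
theorem le_blockCost [DecidableEq ι] (hd : 1 ≤ d) (hlr : ∀ e, l e ≤ r e) {n : ℕ}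
    (hr : ∀ e, r e < n) (hn : 0 < n) (hc0 : c 0 = 0) (hcn : c n = 0)
    (hc : ∀ k, 0 < k → k < n → 1 ≤ c k)
    (hE : ∀ a b, a < b → b ≤ n → 3 ≤ (innerEdges E l r a b).card + c a + c b) :
    4 * (n : ℝ) + 2 * d - 2 - 2 * n / (d + 1) ≤ blockCost E l r c d 0 n := by
  set A := (Finset.Ioo 0 n).filter fun k => c k = 1 with hA
  rcases A.eq_empty_or_nonempty with hempty | hne
  · refine le_blockCost_of_two_le hd hlr hn hc0 hcn (fun k hk hkn => ?_) hE
    have := hc k hk hkn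
    by_contra hcon
    have : k ∈ A := by simp only [hA, Finset.mem_filter, Finset.mem_Ioo]; omega
    simp [hempty] at this
  · obtain ⟨b, hb, hbmax⟩ := Finset.exists_max_image A id hne
    simp only [hA, Finset.mem_filter, Finset.mem_Ioo, id] at hb hbmax
    obtain ⟨⟨hb0, hbn⟩, hcb⟩ := hb
    have hleft := le_blockCost_of_eq_one hd hlr hc0 hc hE b hb0 hbn hcb
    have hright := le_blockCost_right (E := E) hd hbn hcb hlr hr
      (fun k hk hkn => by
        have := hc k (by omega) hkn
        by_contra hcon
        have := hbmax k (by omega)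
        omega)
      (fun k hk hkn => by have := hE k n hkn le_rfl; omega)
    have hadd := blockCost_add_le (E := E) (c := c) (d := d) hlr hb0 hbn
    rw [hcb] at hadd
    push_cast at hadd
    have : 2 * (n : ℝ) / (d + 1) = 2 * b / (d + 1) + 2 * ((n : ℝ) - b) / (d + 1) := by ring
    linarith

end Intervals

section CyclicSequences

variable {N : ℕ} {P : ℕ → Prop}

lemma exists_exit (hN : P N ↔ P 0) (hi : ∃ i < N, P i) (hj : ∃ j < N, ¬ P j) :
    ∃ i < N, P i ∧ ¬ P (i + 1) := by
  by_contra! hstep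
  obtain ⟨i, hiN, hPi⟩ := hi
  obtain ⟨j, hjN, hPj⟩ := hj
  have hprop : ∀ a b, a ≤ b → b ≤ N → P a → P b := by
    intro a b hab
    induction b, hab using Nat.le_induction with
    | base => exact fun _ h => h
    | succ b _ ih => exact fun hb h => hstep b hb (ih (by omega) h)
  exact hPj (hprop 0 j (by omega) hjN.le (hN.1 (hprop i N hiN.le le_rfl hPi)))

lemma card_exit_eq_card_enter [DecidablePred P] (hN : P N ↔ P 0) :
    ((Finset.range N).filter fun i => P i ∧ ¬ P (i + 1)).card =
      ((Finset.range N).filter fun i => ¬ P i ∧ P (i + 1)).card := by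
  have h := Finset.sum_range_sub (fun i => if P i then (1 : ℤ) else 0) N
  simp only [hN, sub_self] at h
  zify
  rw [Finset.card_filter, Finset.card_filter]
  push_cast
  rw [← sub_eq_zero, ← Finset.sum_sub_distrib]
  refine Eq.trans ?_ (neg_eq_zero.2 h)
  rw [← Finset.sum_neg_distrib]
  refine Finset.sum_congr rfl fun i _ => ?_
  by_cases h1 : P i <;> by_cases h2 : P (i + 1) <;> simp only [h1, h2] <;> norm_num

end CyclicSequences

section Tour

variable {n : ℕ} {d : ℝ} {t : ℕ → Fin n × Fin 3}

/-- The number of steps of `t` that cross the line to the left of column `k` from left to right. -/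
def crossings (t : ℕ → Fin n × Fin 3) (k : ℕ) : ℕ :=
  ((Finset.range (3 * n)).filter fun i => (t i).1.val < k ∧ ¬ (t (i + 1)).1.val < k).card

/-- The steps of `t` between different rows. -/
def rowChanges (t : ℕ → Fin n × Fin 3) : Finset ℕ :=
  (Finset.range (3 * n)).filter fun i => (t i).2 ≠ (t (i + 1)).2

/-- The leftmost column met by the `i`-th step of `t`. -/
def minCol (t : ℕ → Fin n × Fin 3) (i : ℕ) : ℕ := min (t i).1.val (t (i + 1)).1.val

/-- The rightmost column met by the `i`-th step of `t`. -/
def maxCol (t : ℕ → Fin n × Fin 3) (i : ℕ) : ℕ := max (t i).1.val (t (i + 1)).1.val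

lemma crossings_eq_card_enter (ht : IsTour n t) (k : ℕ) :
    crossings t k =
      ((Finset.range (3 * n)).filter fun i => ¬ (t i).1.val < k ∧ (t (i + 1)).1.val < k).card :=
  card_exit_eq_card_enter (P := fun i => (t i).1.val < k) (by rw [ht.2])

lemma IsTour.exists_eq (ht : IsTour n t) (p : Fin n × Fin 3) : ∃ i < 3 * n, t i = p := by
  obtain ⟨i, hi⟩ := ht.1.2 p
  exact ⟨i, i.2, hi⟩

lemma one_le_crossings (ht : IsTour n t) {k : ℕ} (hk : 0 < k) (hkn : k < n) :
    1 ≤ crossings t k := by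
  obtain ⟨i, hi, hti⟩ := ht.exists_eq (⟨0, by omega⟩, 0)
  obtain ⟨j, hj, htj⟩ := ht.exists_eq (⟨k, hkn⟩, 0)
  obtain ⟨e, he, h⟩ := exists_exit (P := fun i => (t i).1.val < k) (by rw [ht.2])
    ⟨i, hi, by simpa [hti] using hk⟩ ⟨j, hj, by simp [htj]⟩
  exact Finset.card_pos.2 ⟨e, by simpa [he] using h⟩

lemma three_le_card_innerEdges (ht : IsTour n t) {a b : ℕ} (hab : a < b) (hbn : b ≤ n) :
    3 ≤ (innerEdges (rowChanges t) (minCol t) (maxCol t) a b).card + crossings t a +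
      crossings t b := by
  have hexit : ∀ s : Fin 3, ∃ i < 3 * n, (a ≤ (t i).1.val ∧ (t i).1.val < b ∧ (t i).2 = s) ∧
      ¬ (a ≤ (t (i + 1)).1.val ∧ (t (i + 1)).1.val < b ∧ (t (i + 1)).2 = s) := by
    intro s
    obtain ⟨i, hi, hti⟩ := ht.exists_eq (⟨a, by omega⟩, s)
    obtain ⟨j, hj, htj⟩ := ht.exists_eq (⟨a, by omega⟩, s + 1)
    exact exists_exit (P := fun i => a ≤ (t i).1.val ∧ (t i).1.val < b ∧ (t i).2 = s)
      (by rw [ht.2]) ⟨i, hi, by simp [hti, hab]⟩ ⟨j, hj, by simp [htj]⟩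
  choose f hfN hf hf' using hexit
  have hinj : Function.Injective f := fun s s' h => by rw [← (hf s).2.2, ← (hf s').2.2, h]
  have hcard : (Finset.univ.image f).card = 3 := by
    rw [Finset.card_image_of_injective _ hinj]
    simp
  rw [crossings_eq_card_enter ht a]
  suffices hsub : Finset.univ.image f ⊆
      innerEdges (rowChanges t) (minCol t) (maxCol t) a b ∪
        ((Finset.range (3 * n)).filter fun i =>
          ¬ (t i).1.val < a ∧ (t (i + 1)).1.val < a) ∪
        (Finset.range (3 * n)).filter fun i => (t i).1.val < b ∧ ¬ (t (i + 1)).1.val < b from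
    hcard.ge.trans ((Finset.card_le_card hsub).trans ((Finset.card_union_le _ _).trans
      (Nat.add_le_add_right (Finset.card_union_le _ _) _)))
  intro i hi
  obtain ⟨s, -, rfl⟩ := Finset.mem_image.1 hi
  have h1 := hf s
  have h2 := hf' s
  have h3 := hfN s
  simp only [Finset.mem_union, innerEdges, rowChanges, Finset.mem_filter, Finset.mem_range]
  simp only [minCol, maxCol]
  by_cases h4 : (t (f s + 1)).1.val < a
  · left; right
    omega
  by_cases h5 : (t (f s + 1)).1.val < b
  · left; left
    refine ⟨⟨h3, fun h => h2 ⟨by omega, h5, h ▸ h1.2.2⟩⟩, by omega, by omega⟩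
  · right
    omega

lemma sum_maxCol_sub_minCol (ht : IsTour n t) :
    ∑ i ∈ Finset.range (3 * n), ((maxCol t i - minCol t i : ℕ) : ℝ) =
      2 * ∑ k ∈ Finset.Ioo 0 n, (crossings t k : ℝ) := by
  have hcount : ∀ i, maxCol t i - minCol t i = ∑ k ∈ Finset.Ioo 0 n,
      ((if (t i).1.val < k ∧ ¬ (t (i + 1)).1.val < k then 1 else 0) +
        if ¬ (t i).1.val < k ∧ (t (i + 1)).1.val < k then 1 else 0) := by
    intro i
    have hset : (Finset.Ioc (minCol t i) (maxCol t i)) = (Finset.Ioo 0 n).filter fun k =>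
        ((t i).1.val < k ∧ ¬ (t (i + 1)).1.val < k) ∨
          (¬ (t i).1.val < k ∧ (t (i + 1)).1.val < k) := by
      ext k
      have := (t i).1.2
      have := (t (i + 1)).1.2
      simp only [minCol, maxCol, Finset.mem_Ioc, Finset.mem_filter, Finset.mem_Ioo]
      omega
    rw [← Nat.card_Ioc, hset, Finset.card_filter]
    refine Finset.sum_congr rfl fun k _ => ?_
    split_ifs <;> omega
  have hnat : ∑ i ∈ Finset.range (3 * n), (maxCol t i - minCol t i) =
      2 * ∑ k ∈ Finset.Ioo 0 n, crossings t k := by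
    rw [Finset.sum_congr rfl fun i _ => hcount i, Finset.sum_comm, Finset.mul_sum]
    refine Finset.sum_congr rfl fun k _ => ?_
    rw [Finset.sum_add_distrib, ← Finset.card_filter, ← Finset.card_filter,
      ← crossings_eq_card_enter ht k, two_mul]
    rfl
  exact_mod_cast hnat

lemma pt_fst_sub_sq (i : ℕ) : ((pt n d (t i)).1 - (pt n d (t (i + 1))).1) ^ 2 =
    ((maxCol t i - minCol t i : ℕ) : ℝ) ^ 2 := by
  have h : (pt n d (t i)).1 - (pt n d (t (i + 1))).1 = ((t i).1.val : ℝ) - (t (i + 1)).1.val := by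
    simp [pt]
  rw [h]
  unfold maxCol minCol
  rcases le_total (t i).1.val (t (i + 1)).1.val with h | h
  · rw [max_eq_right h, min_eq_left h, Nat.cast_sub h]
    ring
  · rw [max_eq_left h, min_eq_right h, Nat.cast_sub h]

lemma sq_le_pt_snd_sub_sq {p q : Fin n × Fin 3} (h : p.2 ≠ q.2) :
    d ^ 2 ≤ ((pt n d p).2 - (pt n d q).2) ^ 2 := by
  have h1 : (pt n d p).2 - (pt n d q).2 = ((p.2.val : ℤ) - q.2.val : ℤ) * d := by
    simp only [pt]
    push_cast
    ring
  rw [h1, mul_pow]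
  have h2 : (1 : ℝ) ≤ (((p.2.val : ℤ) - q.2.val : ℤ) : ℝ) ^ 2 := by
    rw [one_le_sq_iff_one_le_abs, ← Int.cast_abs]
    have : (p.2.val : ℤ) - q.2.val ≠ 0 := fun h0 => h (Fin.ext (by omega))
    exact_mod_cast Int.one_le_abs this
  nlinarith [sq_nonneg d]

lemma le_eucl_step (i : ℕ) :
    ((maxCol t i - minCol t i : ℕ) : ℝ) +
      (if (t i).2 ≠ (t (i + 1)).2 then diagGain d (maxCol t i - minCol t i) else 0) ≤
      eucl (pt n d (t i)) (pt n d (t (i + 1))) := by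
  unfold eucl
  rw [pt_fst_sub_sq]
  split_ifs with h
  · unfold diagGain
    have := Real.sqrt_le_sqrt (add_le_add_right (sq_le_pt_snd_sub_sq (d := d) h)
      (((maxCol t i - minCol t i : ℕ) : ℝ) ^ 2))
    linarith
  · rw [add_zero]
    exact Real.le_sqrt_of_sq_le (le_add_of_nonneg_right (sq_nonneg _))

lemma le_tourLength (hd : 1 ≤ d) (hn : 0 < n) (ht : IsTour n t) :
    4 * (n : ℝ) + 2 * d - 2 - 2 * n / (d + 1) ≤ tourLength n d t := by
  have hcore := le_blockCost (E := rowChanges t) (l := minCol t) (r := maxCol t)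
    (c := crossings t) (n := n) hd (fun i => min_le_max)
    (fun i => max_lt (t i).1.2 (t (i + 1)).1.2) hn (by simp [crossings])
    (by simp [crossings]) (fun k hk hkn => one_le_crossings ht hk hkn)
    (fun a b hab hbn => three_le_card_innerEdges ht hab hbn)
  refine hcore.trans ?_
  have hstep := Finset.sum_le_sum fun i (_ : i ∈ Finset.range (3 * n)) =>
    le_eucl_step (n := n) (d := d) (t := t) i
  rw [Finset.sum_add_distrib, sum_maxCol_sub_minCol ht, ← Finset.sum_filter] at hstep
  refine le_trans (add_le_add_right ?_ _) hstep
  exact Finset.sum_le_sum_of_subset_of_nonneg (Finset.filter_subset _ _)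
    fun _ _ _ => diagGain_nonneg _ _

lemma exists_isTour (n : ℕ) (hn : 0 < n) : ∃ t, IsTour n t := by
  have e : Fin (3 * n) ≃ Fin n × Fin 3 := Fintype.equivOfCardEq (by simp [mul_comm])
  have h3 : 0 < 3 * n := by omega
  refine ⟨fun i => e ⟨i % (3 * n), Nat.mod_lt _ h3⟩, ?_, by simp⟩
  convert e.bijective using 1
  ext1 i
  simp only [Nat.mod_eq_of_lt i.2]

lemma le_optTour (hd : 1 ≤ d) (hn : 0 < n) :
    4 * (n : ℝ) + 2 * d - 2 - 2 * n / (d + 1) ≤ optTour n d := by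
  obtain ⟨t, ht⟩ := exists_isTour n hn
  refine le_csInf ⟨_, t, ht, rfl⟩ ?_
  rintro _ ⟨t, ht, rfl⟩
  exact le_tourLength hd hn ht

end Tour

section LP

variable {m : ℕ}

/-- The indicator of a step to the right within a row. -/
def rowStep (p q : Fin (m + 2) × Fin 3) : ℝ :=
  if p.2 = q.2 ∧ p.1.val + 1 = q.1.val then 1 else 0

/-- The indicator of a pair of distinct points in the first or in the last column. -/
def endPair (p q : Fin (m + 2) × Fin 3) : ℝ :=
  if p.2 ≠ q.2 ∧ p.1 = q.1 ∧ (p.1 = 0 ∨ p.1 = Fin.last (m + 1)) then 1 else 0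

/-- The half-integral solution of the subtour LP: the three rows as paths, joined by triangles of
weight `1/2` in the first and in the last column. -/
def halfTriangles (p q : Fin (m + 2) × Fin 3) : ℝ :=
  rowStep p q + rowStep q p + 1 / 2 * endPair p q

lemma sum_rowStep (φ : Fin (m + 2) × Fin 3 → Fin (m + 2) × Fin 3 → ℝ) :
    ∑ p, ∑ q, φ p q * rowStep p q =
      ∑ s, ∑ k : Fin (m + 1), φ (k.castSucc, s) (k.succ, s) := by
  have hrow : ∀ p : Fin (m + 2) × Fin 3, ∑ q, φ p q * rowStep p q =
      ∑ k : Fin (m + 1), if p.1 = k.castSucc then φ p (k.succ, p.2) else 0 := by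
    intro p
    rw [Fintype.sum_prod_type, Fin.sum_univ_succ]
    have h0 : ∑ s, φ p (0, s) * rowStep p (0, s) = 0 :=
      Finset.sum_eq_zero fun s _ => by simp [rowStep]
    rw [h0, zero_add]
    refine Finset.sum_congr rfl fun k _ => ?_
    have hk : p.1.val + 1 = k.succ.val ↔ p.1 = k.castSucc := by simp [Fin.ext_iff]
    simp only [rowStep, hk]
    simp [ite_and]
  simp_rw [hrow, Fintype.sum_prod_type_right]
  refine Finset.sum_congr rfl fun s _ => ?_
  rw [Finset.sum_comm]
  simp

lemma sum_endPair (φ : Fin (m + 2) × Fin 3 → Fin (m + 2) × Fin 3 → ℝ) :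
    ∑ p, ∑ q, φ p q * endPair p q =
      ∑ s, ∑ s', if s ≠ s' then φ (0, s) (0, s') +
        φ (Fin.last (m + 1), s) (Fin.last (m + 1), s') else 0 := by
  have hrow : ∀ p : Fin (m + 2) × Fin 3, ∑ q, φ p q * endPair p q =
      ∑ s', if p.2 ≠ s' then (if p.1 = 0 then φ p (0, s') else 0) +
        (if p.1 = Fin.last (m + 1) then φ p (Fin.last (m + 1), s') else 0) else 0 := by
    intro p
    rw [Fintype.sum_prod_type_right]
    refine Finset.sum_congr rfl fun s' _ => ?_
    rw [Finset.sum_eq_single p.1 (fun i _ hi => by simp [endPair, hi.symm]) (by simp)]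
    have hne : (0 : Fin (m + 2)) ≠ Fin.last (m + 1) := (Fin.last_pos).ne
    by_cases h0 : p.1 = 0
    · simp [endPair, h0, hne]
    · by_cases h1 : p.1 = Fin.last (m + 1)
      · simp [endPair, h1, hne.symm]
      · simp [endPair, h0, h1]
  simp_rw [hrow, Fintype.sum_prod_type_right]
  refine Finset.sum_congr rfl fun s _ => ?_
  rw [Finset.sum_comm]
  refine Finset.sum_congr rfl fun s' _ => ?_
  by_cases h : s = s' <;> simp [h, Finset.sum_add_distrib]

lemma sum_mul_halfTriangles (φ : Fin (m + 2) × Fin 3 → Fin (m + 2) × Fin 3 → ℝ) :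
    ∑ p, ∑ q, φ p q * halfTriangles p q =
      ∑ s, ∑ k : Fin (m + 1), (φ (k.castSucc, s) (k.succ, s) + φ (k.succ, s) (k.castSucc, s)) +
      1 / 2 * ∑ s, ∑ s', if s ≠ s' then φ (0, s) (0, s') +
        φ (Fin.last (m + 1), s) (Fin.last (m + 1), s') else 0 := by
  have hswap : ∑ p, ∑ q, φ p q * rowStep q p = ∑ p, ∑ q, φ q p * rowStep p q := Finset.sum_comm
  have hend : ∑ p, ∑ q, φ p q * (1 / 2 * endPair p q) =
      1 / 2 * ∑ p, ∑ q, φ p q * endPair p q := by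
    simp_rw [Finset.mul_sum]
    exact Finset.sum_congr rfl fun _ _ => Finset.sum_congr rfl fun _ _ => mul_left_comm _ _ _
  simp_rw [halfTriangles, mul_add, Finset.sum_add_distrib]
  rw [hswap, hend, sum_endPair, sum_rowStep, sum_rowStep]

lemma halfTriangles_symm (p q : Fin (m + 2) × Fin 3) : halfTriangles p q = halfTriangles q p := by
  have : endPair p q = endPair q p := by
    unfold endPair
    congr 1
    grind
  unfold halfTriangles
  rw [this]
  ring

lemma sum_halfTriangles (p : Fin (m + 2) × Fin 3) : ∑ q, halfTriangles p q = 2 := by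
  have h := sum_mul_halfTriangles (fun p' _ => if p' = p then (1 : ℝ) else 0)
  simp only [ite_mul, one_mul, zero_mul, Finset.sum_ite_irrel, Finset.sum_const_zero,
    Finset.sum_ite_eq', Finset.mem_univ, if_true] at h
  rw [h]
  obtain ⟨i, s⟩ := p
  have hleft : ∑ k : Fin (m + 1), (if k.castSucc = i then (1 : ℝ) else 0) =
      if i = Fin.last (m + 1) then 0 else 1 := by
    cases i using Fin.lastCases <;> simp [Fin.castSucc_ne_last]
  have hright : ∑ k : Fin (m + 1), (if k.succ = i then (1 : ℝ) else 0) =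
      if i = 0 then 0 else 1 := by
    cases i using Fin.cases <;> simp [Fin.succ_ne_zero]
  have hrows : ∑ s', ∑ k : Fin (m + 1), ((if (k.castSucc, s') = (i, s) then (1 : ℝ) else 0) +
      if (k.succ, s') = (i, s) then 1 else 0) =
      (if i = Fin.last (m + 1) then 0 else 1) + if i = 0 then 0 else 1 := by
    rw [Finset.sum_comm, ← hleft, ← hright, ← Finset.sum_add_distrib]
    refine Finset.sum_congr rfl fun k _ => ?_
    simp [Finset.sum_add_distrib, Prod.mk.injEq, ite_and]
  rw [hrows]
  have hends : ∑ s', ∑ s'', (if s' ≠ s'' then (if ((0 : Fin (m + 2)), s') = (i, s) then (1 : ℝ)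
      else 0) + (if (Fin.last (m + 1), s') = (i, s) then 1 else 0) else 0) =
      2 * ((if i = 0 then 1 else 0) + if i = Fin.last (m + 1) then 1 else 0) := by
    rw [Finset.sum_eq_single s (fun s' _ hs' => by simp [hs']) (by simp)]
    simp only [Prod.mk.injEq, and_true, eq_comm (b := i), ← Finset.sum_filter, Finset.sum_const,
      Finset.filter_ne, Finset.card_erase_of_mem (Finset.mem_univ s)]
    simp only [Finset.card_univ, Fintype.card_fin, nsmul_eq_mul]
    norm_num
  rw [hends]
  split_ifs <;> norm_num

lemma halfTriangles_mem_Icc (p q : Fin (m + 2) × Fin 3) :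
    0 ≤ halfTriangles p q ∧ halfTriangles p q ≤ 1 := by
  unfold halfTriangles rowStep endPair
  split_ifs <;> first | (exfalso; grind) | norm_num

/-- A cut that separates a row end from another one meets the rows and twice the triangles with
total weight at least `2`, in terms of the sides `u` and `v` of the first and last points. -/
lemma cut_row_ends (u v : Fin 3 → Bool) (h : ¬ ∀ s, u s = u 0 ∧ v s = u 0) :
    8 ≤ 4 * (∑ s, if u s = v s then 0 else 1) +
      ∑ s, ∑ s', if s ≠ s' then (if u s = u s' then 0 else 1) + (if v s = v s' then 0 else 1)
        else 0 := by
  revert u v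
  decide

lemma abs_add_abs_le_sum (f : Fin (m + 2) → ℝ) (i : Fin (m + 2)) :
    |f 0 - f i| + |f i - f (Fin.last (m + 1))| ≤
      ∑ k : Fin (m + 1), |f k.castSucc - f k.succ| := by
  set g : ℕ → ℝ := fun k => if h : k < m + 2 then f ⟨k, h⟩ else 0 with hg
  have hfg : ∀ j : Fin (m + 2), f j = g j := fun j => by simp [hg]
  have hsum : ∑ k : Fin (m + 1), |f k.castSucc - f k.succ| =
      ∑ k ∈ Finset.range (m + 1), dist (g k) (g (k + 1)) := by
    rw [← Fin.sum_univ_eq_sum_range (fun k => dist (g k) (g (k + 1)))]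
    refine Finset.sum_congr rfl fun k _ => ?_
    rw [hfg, hfg, Real.dist_eq]
    rfl
  have hi : i.val ≤ m + 1 := Nat.lt_succ_iff.1 i.2
  rw [hsum, Finset.range_eq_Ico, ← Finset.sum_Ico_consecutive _ (Nat.zero_le i.val) hi,
    hfg, hfg i, hfg, ← Real.dist_eq, ← Real.dist_eq]
  exact add_le_add (dist_le_Ico_sum_dist g (Nat.zero_le _)) (dist_le_Ico_sum_dist g hi)

lemma four_le_cut_halfTriangles {S : Finset (Fin (m + 2) × Fin 3)} (hS : S.Nonempty)
    (hS' : S ≠ Finset.univ) (f : Fin (m + 2) × Fin 3 → ℝ)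
    (hf : ∀ p, f p = if p ∈ S then 1 else 0) :
    4 ≤ ∑ p, ∑ q, |f p - f q| * halfTriangles p q := by
  have habs : ∀ p q, |f p - f q| = ((if decide (p ∈ S) = decide (q ∈ S) then 0 else 1 : ℕ) : ℝ) := by
    intro p q
    by_cases hp : p ∈ S <;> by_cases hq : q ∈ S <;> simp [hf, hp, hq]
  have hrow : ∀ s i, |f (0, s) - f (i, s)| + |f (i, s) - f (Fin.last (m + 1), s)| ≤
      ∑ k : Fin (m + 1), |f (k.castSucc, s) - f (k.succ, s)| := fun s i =>
    abs_add_abs_le_sum (fun i => f (i, s)) i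
  rw [sum_mul_halfTriangles]
  simp_rw [abs_sub_comm (f (Fin.succ _, _)), ← two_mul, ← Finset.mul_sum]
  by_cases hex : ∃ s i, f (0, s) = f (Fin.last (m + 1), s) ∧ f (i, s) ≠ f (0, s)
  · obtain ⟨s, i, hends, hi⟩ := hex
    have h1 : |f (0, s) - f (i, s)| = 1 := by
      have := habs (0, s) (i, s)
      split_ifs at this with h
      · simp [hf, decide_eq_decide.1 h] at hi
      · simpa using this
    have h2 := hrow s i
    rw [← hends, abs_sub_comm (f (i, s)), h1] at h2
    have h3 := Finset.single_le_sum (f := fun s =>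
      ∑ k : Fin (m + 1), |f (k.castSucc, s) - f (k.succ, s)|)
      (fun s _ => Finset.sum_nonneg fun _ _ => abs_nonneg _) (Finset.mem_univ s)
    have h4 : 0 ≤ ∑ s, ∑ s', if s ≠ s' then |f (0, s) - f (0, s')| +
        |f (Fin.last (m + 1), s) - f (Fin.last (m + 1), s')| else 0 :=
      Finset.sum_nonneg fun _ _ => Finset.sum_nonneg fun _ _ => by split_ifs <;> positivity
    linarith
  · push Not at hex
    have hends := cut_row_ends (fun s => decide ((0, s) ∈ S))
      (fun s => decide ((Fin.last (m + 1), s) ∈ S)) fun hall => by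
        have hconst : ∀ p, f p = f (0, 0) := by
          rintro ⟨i, s⟩
          have h1 := hall s
          simp only [decide_eq_decide] at h1
          have h2 : f (0, s) = f (0, 0) := by simp [hf, h1.1]
          have h3 : f (Fin.last (m + 1), s) = f (0, 0) := by simp [hf, h1.2]
          rw [hex s i (h2.trans h3.symm), h2]
        obtain ⟨p, hp⟩ := hS
        refine hS' (Finset.eq_univ_iff_forall.2 fun q => ?_)
        have := (hconst q).trans (hconst p).symm
        by_contra hq
        simp [hf, hp, hq] at this
    have hends' := (Nat.cast_le (α := ℝ)).2 hends
    push_cast at hends'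
    simp only [habs]
    have h1 : ∀ s, |f (0, s) - f (Fin.last (m + 1), s)| ≤ _ := fun s => by
      simpa using hrow s (Fin.last (m + 1))
    have h2 := Finset.sum_le_sum fun s (_ : s ∈ Finset.univ) => h1 s
    simp only [habs] at h2
    push_cast at h2 ⊢
    linarith

lemma halfTriangles_feasible : SubtourLPFeasible (m + 2) halfTriangles := by
  refine ⟨halfTriangles_symm, fun p => by simp [halfTriangles, rowStep, endPair],
    halfTriangles_mem_Icc, sum_halfTriangles, fun S hS hS' => ?_⟩
  set f : Fin (m + 2) × Fin 3 → ℝ := fun p => if p ∈ S then 1 else 0 with hf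
  have hcut := four_le_cut_halfTriangles hS hS' f fun _ => rfl
  have hinner : ∑ p ∈ S, ∑ q ∈ S, halfTriangles p q =
      ∑ p, ∑ q, f p * f q * halfTriangles p q := by
    simp [hf]
  have hcard : ∑ p, ∑ q, f p * halfTriangles p q = 2 * S.card := by
    simp_rw [← Finset.mul_sum, sum_halfTriangles]
    simp [hf, mul_comm]
  have hcard' : ∑ p, ∑ q, f q * halfTriangles p q = 2 * S.card := by
    rw [Finset.sum_comm, ← hcard]
    simp_rw [halfTriangles_symm]
  have hsplit : ∑ p, ∑ q, |f p - f q| * halfTriangles p q =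
      ∑ p, ∑ q, f p * halfTriangles p q + ∑ p, ∑ q, f q * halfTriangles p q -
        2 * ∑ p, ∑ q, f p * f q * halfTriangles p q := by
    simp_rw [Finset.mul_sum, ← Finset.sum_add_distrib, ← Finset.sum_sub_distrib]
    refine Finset.sum_congr rfl fun p _ => Finset.sum_congr rfl fun q _ => ?_
    by_cases hp : p ∈ S <;> by_cases hq : q ∈ S <;> (simp [hf, hp, hq]; try ring)
  rw [hinner]
  linarith

lemma lpValue_halfTriangles {d : ℝ} (hd : 0 ≤ d) :
    lpValue (m + 2) d halfTriangles = 3 * ((m : ℝ) + 1) + 4 * d := by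
  have hrow : ∀ (s : Fin 3) (k : Fin (m + 1)),
      eucl (pt (m + 2) d (k.castSucc, s)) (pt (m + 2) d (k.succ, s)) = 1 ∧
      eucl (pt (m + 2) d (k.succ, s)) (pt (m + 2) d (k.castSucc, s)) = 1 := by
    intro s k
    constructor <;> simp [eucl, pt]
  have hcol : ∀ (i : Fin (m + 2)) (s s' : Fin 3),
      eucl (pt (m + 2) d (i, s)) (pt (m + 2) d (i, s')) = |(s.val : ℝ) - s'.val| * d := by
    intro i s s'
    simp only [eucl, pt, sub_self]
    rw [show |(s.val : ℝ) - s'.val| * d = |((s.val : ℝ) - s'.val) * d| by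
      rw [abs_mul, abs_of_nonneg hd], ← Real.sqrt_sq_eq_abs]
    congr 1
    ring
  unfold lpValue
  rw [sum_mul_halfTriangles]
  simp only [hrow, hcol, Fin.sum_univ_three]
  simp
  norm_num
  ring

lemma one_le_eucl_pt {n : ℕ} {d : ℝ} (hd : 1 ≤ d) {p q : Fin n × Fin 3} (h : p ≠ q) :
    1 ≤ eucl (pt n d p) (pt n d q) := by
  apply Real.le_sqrt_of_sq_le
  by_cases hrow : p.2 = q.2
  · have hcol : (p.1.val : ℤ) - q.1.val ≠ 0 := fun h0 => h (Prod.ext (Fin.ext (by omega)) hrow)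
    have h1 : (1 : ℝ) ≤ (((p.1.val : ℤ) - q.1.val : ℤ) : ℝ) ^ 2 := by
      rw [one_le_sq_iff_one_le_abs, ← Int.cast_abs]
      exact_mod_cast Int.one_le_abs hcol
    have h2 : (pt n d p).1 - (pt n d q).1 = ((p.1.val : ℤ) - q.1.val : ℤ) := by
      simp [pt]
    rw [h2]
    nlinarith [sq_nonneg ((pt n d p).2 - (pt n d q).2)]
  · have := sq_le_pt_snd_sub_sq (d := d) hrow
    nlinarith [sq_nonneg ((pt n d p).1 - (pt n d q).1)]

lemma le_lpValue {n : ℕ} {d : ℝ} (hd : 1 ≤ d) {x : Fin n × Fin 3 → Fin n × Fin 3 → ℝ}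
    (hx : SubtourLPFeasible n x) : 3 * (n : ℝ) ≤ lpValue n d x := by
  obtain ⟨-, hdiag, hbox, hdeg, -⟩ := hx
  have hsum : ∑ p : Fin n × Fin 3, ∑ q, x p q = 6 * n := by
    simp_rw [hdeg]
    simp
    ring
  have hle : ∑ p, ∑ q, x p q ≤ ∑ p, ∑ q, eucl (pt n d p) (pt n d q) * x p q := by
    refine Finset.sum_le_sum fun p _ => Finset.sum_le_sum fun q _ => ?_
    by_cases h : p = q
    · simp [h, hdiag]
    · exact le_mul_of_one_le_left (hbox p q).1 (one_le_eucl_pt hd h)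
  unfold lpValue
  linarith

lemma optLP_le {n : ℕ} {d : ℝ} (hd : 1 ≤ d) (hn : 2 ≤ n) : optLP n d ≤ 3 * n + 4 * d := by
  obtain ⟨m, rfl⟩ := Nat.exists_eq_add_of_le' hn
  have hbdd : BddBelow {L | ∃ x, SubtourLPFeasible (m + 2) x ∧ lpValue (m + 2) d x = L} :=
    ⟨_, by rintro _ ⟨x, hx, rfl⟩; exact le_lpValue hd hx⟩
  refine (csInf_le hbdd ⟨_, halfTriangles_feasible, lpValue_halfTriangles (by linarith)⟩).trans ?_
  push_cast
  linarith

lemma optLP_pos {n : ℕ} {d : ℝ} (hd : 1 ≤ d) (hn : 2 ≤ n) : 0 < optLP n d := by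
  obtain ⟨m, rfl⟩ := Nat.exists_eq_add_of_le' hn
  have h : 3 * ((m + 2 : ℕ) : ℝ) ≤ optLP (m + 2) d := by
    refine le_csInf ⟨_, halfTriangles, halfTriangles_feasible, rfl⟩ ?_
    rintro _ ⟨x, hx, rfl⟩
    exact le_lpValue hd hx
  exact lt_of_lt_of_le (by positivity) h

end LP

/-- For `n ≥ 3` and `d ≥ 4`, the integrality ratio of the subtour LP for
`G(n,d)` is at least `(4n + 2d − 2 − 2n/(d+1)) / (3n + 4d)`. -/
theorem statement4 (n : ℕ) (hn : 3 ≤ n) (d : ℝ) (hd : 4 ≤ d) :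
    (4 * (n : ℝ) + 2 * d - 2 - 2 * n / (d + 1)) / (3 * n + 4 * d) ≤
      optTour n d / optLP n d := by
  have hd1 : 1 ≤ d := by linarith
  have hT := le_optTour hd1 (show 0 < n by omega)
  refine div_le_div₀ ?_ hT (optLP_pos hd1 (by omega)) (optLP_le hd1 (by omega))
  have h : 2 * (n : ℝ) / (d + 1) ≤ 2 * n := div_le_self (by positivity) (by linarith)
  have hn' : (3 : ℝ) ≤ n := by exact_mod_cast hn
  linarith

end
end

section
/- Let d ≥ 4 be a real number and let n ≥ 3 be an even natural number. Then every TSP tour of the instance G(n,d) has length at least min over integers k with 1 ≤ k ≤ n/2 of n + 2k + 2d − 2 + 2k · c(n/(2k)), where c(x) := 2(x−1) + √((x−1)² + d²). -/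
open Real Filter Finset

noncomputable section

/-- The columns `a` and rows `b` of a closed walk of `M` steps visiting every point of the
`n × 3` grid. -/
structure GridWalk (n M : ℕ) (a b : ℕ → ℕ) : Prop where
  col_lt : ∀ i, a i < n
  row_lt : ∀ i, b i < 3
  surj : ∀ x < n, ∀ y < 3, ∃ i < M, a i = x ∧ b i = y
  col_closed : a M = a 0
  row_closed : b M = b 0

/-- The steps of `a` going from a value `≤ j` to a value `> j`. -/
def upCross (a : ℕ → ℕ) (M j : ℕ) : Finset ℕ :=
  (range M).filter fun i => a i ≤ j ∧ j < a (i + 1)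

/-- The steps of `a` going from a value `> j` to a value `≤ j`. -/
def downCross (a : ℕ → ℕ) (M j : ℕ) : Finset ℕ :=
  (range M).filter fun i => a (i + 1) ≤ j ∧ j < a i

/-- The steps at which `b` changes. -/
def changes (b : ℕ → ℕ) (M : ℕ) : Finset ℕ :=
  (range M).filter fun i => b i ≠ b (i + 1)

/-- The cuts between columns that are crossed upwards exactly once. -/
def simpleCuts (a : ℕ → ℕ) (n M : ℕ) : Finset ℕ :=
  (range (n - 1)).filter fun j => #(upCross a M j) = 1

/-- The absolute difference between consecutive values of `a`. -/
def stepSize (a : ℕ → ℕ) (i : ℕ) : ℕ := ((a i : ℤ) - a (i + 1)).natAbs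

theorem exists_exit_s11 {M : ℕ} {P : ℕ → Prop} (hM : P M → P 0) (h₁ : ∃ i < M, P i)
    (h₂ : ∃ i < M, ¬ P i) : ∃ i < M, P i ∧ ¬ P (i + 1) := by
  by_contra! h
  have step : ∀ i, P i → ∀ k, i + k ≤ M → P (i + k) := by
    intro i hi k
    induction k with
    | zero => intro _; exact hi
    | succ k ih => intro hk; exact h (i + k) (by omega) (ih (by omega))
  obtain ⟨i, hi, hPi⟩ := h₁
  obtain ⟨j, hj, hPj⟩ := h₂
  have hPM : P M := by
    have := step i hPi (M - i) (by omega)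
    rwa [Nat.add_sub_cancel' hi.le] at this
  have := step 0 (hM hPM) j (by omega)
  rw [zero_add] at this
  exact hPj this

theorem card_downCross {a : ℕ → ℕ} {M : ℕ} (h : a M = a 0) (j : ℕ) :
    #(downCross a M j) = #(upCross a M j) := by
  have key : ∑ i ∈ range M, (((if a i ≤ j ∧ j < a (i + 1) then 1 else 0 : ℤ)) -
      (if a (i + 1) ≤ j ∧ j < a i then 1 else 0)) = 0 := by
    rw [Finset.sum_congr rfl (g := fun i => (if a i ≤ j then 1 else 0 : ℤ) -
      (if a (i + 1) ≤ j then 1 else 0)), Finset.sum_range_sub', h, sub_self]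
    intro i _
    split_ifs <;> omega
  rw [Finset.sum_sub_distrib] at key
  simp only [upCross, downCross, Finset.card_filter]
  rw [← Nat.cast_inj (R := ℤ)]
  push_cast
  linarith

theorem disjoint_upCross_downCross (a : ℕ → ℕ) (M j : ℕ) :
    Disjoint (upCross a M j) (downCross a M j) := by
  rw [Finset.disjoint_left]
  intro i
  simp only [upCross, downCross, mem_filter]
  omega

theorem stepSize_eq_sum {a : ℕ → ℕ} {n : ℕ} (ha : ∀ i, a i < n) (i : ℕ) :
    stepSize a i = ∑ j ∈ range (n - 1),
      if (a i ≤ j ∧ j < a (i + 1)) ∨ (a (i + 1) ≤ j ∧ j < a i) then 1 else 0 := by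
  have h1 := ha i
  have h2 := ha (i + 1)
  rw [← Finset.card_filter]
  have : (range (n - 1)).filter
      (fun j => (a i ≤ j ∧ j < a (i + 1)) ∨ (a (i + 1) ≤ j ∧ j < a i)) =
      Finset.Ico (min (a i) (a (i + 1))) (max (a i) (a (i + 1))) := by
    ext j
    simp only [mem_filter, Finset.mem_range, Finset.mem_Ico]
    omega
  rw [this, Nat.card_Ico, stepSize]
  omega

theorem even_sum_stepSize {b : ℕ → ℕ} {M : ℕ} (h : b M = b 0) :
    Even (∑ i ∈ range M, stepSize b i) := by
  have key : (2 : ℤ) ∣ ∑ i ∈ range M, ((stepSize b i : ℤ) - ((b i : ℤ) - b (i + 1))) := by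
    apply Finset.dvd_sum
    intro i _
    simp only [stepSize]
    omega
  rw [Finset.sum_sub_distrib, Finset.sum_range_sub' (fun i => (b i : ℤ)), h, sub_self,
    sub_zero] at key
  rw [even_iff_two_dvd]
  exact_mod_cast key

theorem card_changes_le (b : ℕ → ℕ) (M : ℕ) :
    #(changes b M) ≤ ∑ i ∈ range M, stepSize b i := by
  rw [changes, Finset.card_filter]
  apply Finset.sum_le_sum
  intro i _
  simp only [stepSize]
  split_ifs <;> omega

namespace GridWalk

variable {n M : ℕ} {a b : ℕ → ℕ}

theorem one_le_card_upCross (w : GridWalk n M a b) {j : ℕ} (hj : j < n - 1) :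
    1 ≤ #(upCross a M j) := by
  obtain ⟨i, hi, hai, -⟩ := w.surj 0 (by omega) 0 (by omega)
  obtain ⟨k, hk, hak, -⟩ := w.surj (n - 1) (by omega) 0 (by omega)
  obtain ⟨e, he, h1, h2⟩ := exists_exit_s11 (P := fun i => a i ≤ j)
    (fun h => w.col_closed ▸ h) ⟨i, hi, by omega⟩ ⟨k, hk, by omega⟩
  exact Finset.card_pos.mpr ⟨e, by simp only [upCross, mem_filter, Finset.mem_range]; omega⟩

theorem exists_change_le (w : GridWalk n M a b) {j : ℕ} (hj : j < n - 1)
    (h : #(upCross a M j) ≤ 2) : ∃ e ∈ changes b M, a e ≤ j ∧ a (e + 1) ≤ j := by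
  have hex : ∀ r : Fin 3, ∃ i < M, (a i ≤ j ∧ b i = r) ∧ ¬ (a (i + 1) ≤ j ∧ b (i + 1) = r) := by
    intro r
    obtain ⟨i, hi, hai, hbi⟩ := w.surj 0 (by omega) r r.2
    obtain ⟨k, hk, hak, -⟩ := w.surj (n - 1) (by omega) r r.2
    exact exists_exit_s11 (P := fun i => a i ≤ j ∧ b i = r)
      (fun h => by rw [← w.col_closed, ← w.row_closed]; exact h)
      ⟨i, hi, by omega⟩ ⟨k, hk, by omega⟩
  choose e heM he he' using hex
  by_contra! hno
  have hmaps : ∀ r ∈ (Finset.univ : Finset (Fin 3)), e r ∈ upCross a M j := by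
    intro r _
    have h1 := he r
    have h2 := he' r
    have h3 := hno (e r)
    simp only [changes, upCross, mem_filter, Finset.mem_range] at h3 ⊢
    have := heM r
    by_cases hb : b (e r) = b (e r + 1)
    · omega
    · have := h3 ⟨this, hb⟩
      omega
  have := Finset.card_le_card_of_injOn e hmaps (fun r _ s _ hrs => Fin.ext (by
    rw [← (he r).2, ← (he s).2, hrs]))
  simp at this
  omega

theorem exists_change_gt (w : GridWalk n M a b) {j : ℕ} (hj : j < n - 1)
    (h : #(upCross a M j) ≤ 2) : ∃ e ∈ changes b M, j < a e ∧ j < a (e + 1) := by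
  have hex : ∀ r : Fin 3, ∃ i < M, (j < a i ∧ b i = r) ∧ ¬ (j < a (i + 1) ∧ b (i + 1) = r) := by
    intro r
    obtain ⟨i, hi, hai, -⟩ := w.surj 0 (by omega) r r.2
    obtain ⟨k, hk, hak, hbk⟩ := w.surj (n - 1) (by omega) r r.2
    exact exists_exit_s11 (P := fun i => j < a i ∧ b i = r)
      (fun h => by rw [← w.col_closed, ← w.row_closed]; exact h)
      ⟨k, hk, by omega⟩ ⟨i, hi, by omega⟩
  choose e heM he he' using hex
  by_contra! hno
  have hmaps : ∀ r ∈ (Finset.univ : Finset (Fin 3)), e r ∈ downCross a M j := by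
    intro r _
    have h1 := he r
    have h2 := he' r
    have h3 := hno (e r)
    simp only [changes, downCross, mem_filter, Finset.mem_range] at h3 ⊢
    have := heM r
    by_cases hb : b (e r) = b (e r + 1)
    · omega
    · have := h3 ⟨this, hb⟩
      omega
  have := Finset.card_le_card_of_injOn e hmaps (fun r _ s _ hrs => Fin.ext (by
    rw [← (he r).2, ← (he s).2, hrs]))
  rw [card_downCross w.col_closed] at this
  simp at this
  omega

/-- Cutting the grid at its simple cuts yields `3 * (c + 1)` row segments, each of which is left
by some step; such a step changes rows or crosses a simple cut. -/
theorem card_simpleCuts_add_three_le (w : GridWalk n M a b) (hn : 0 < n) :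
    #(simpleCuts a n M) + 3 ≤ #(changes b M) := by
  set C := simpleCuts a n M with hC
  set A : Finset ℕ := insert 0 (C.image (· + 1)) with hA
  have hAcard : #A = #C + 1 := by
    rw [hA, Finset.card_insert_of_notMem (by simp),
      Finset.card_image_of_injective _ (add_left_injective 1)]
  have hAlt : ∀ x ∈ A, x < n := by
    intro x hx
    simp only [hA, hC, simpleCuts, Finset.mem_insert, Finset.mem_image, mem_filter,
      Finset.mem_range] at hx
    omega
  have hApred : ∀ x ∈ A, x ≠ 0 → x - 1 ∈ C := by
    intro x hx h0
    simp only [hA, Finset.mem_insert, Finset.mem_image] at hx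
    obtain h | ⟨j, hj, rfl⟩ := hx
    · exact absurd h h0
    · simpa using hj
  let P : ℕ × ℕ → ℕ → Prop := fun p i =>
    b i = p.2 ∧ p.1 ≤ a i ∧ ∀ j ∈ C, p.1 ≤ j → a i ≤ j
  have hex : ∀ p : ℕ × ℕ, p ∈ A ×ˢ range 3 → ∃ i < M, P p i ∧ ¬ P p (i + 1) := by
    rintro ⟨x, r⟩ hp
    simp only [Finset.mem_product, Finset.mem_range] at hp
    have hx := hAlt x hp.1
    obtain ⟨i, hi, hai, hbi⟩ := w.surj x hx r hp.2
    obtain ⟨k, hk, -, hbk⟩ := w.surj x hx ((r + 1) % 3) (by omega)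
    refine exists_exit_s11 (fun h => ?_) ⟨i, hi, hbi, hai.ge, fun j _ h => hai ▸ h⟩
      ⟨k, hk, fun h => ?_⟩
    · simp only [P, w.col_closed, w.row_closed] at h
      exact h
    · have : b k = r := h.1
      omega
  choose! e heM he he' using hex
  have hmaps : ∀ p ∈ A ×ˢ range 3, e p ∈ changes b M ∪
      C.biUnion (fun j => upCross a M j ∪ downCross a M j) := by
    intro p hp
    have h1 := heM p hp
    obtain ⟨h2, h3, h4⟩ := he p hp
    have h5 := he' p hp
    have hpA := (Finset.mem_product.mp hp).1
    simp only [Finset.mem_union, Finset.mem_biUnion, changes, upCross, downCross, mem_filter,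
      Finset.mem_range]
    by_cases hb : b (e p) = b (e p + 1)
    · right
      by_cases hlow : p.1 ≤ a (e p + 1)
      · have : ∃ j ∈ C, p.1 ≤ j ∧ j < a (e p + 1) := by
          by_contra! hcon
          exact h5 ⟨hb ▸ h2, hlow, hcon⟩
        obtain ⟨j, hj, hj1, hj2⟩ := this
        exact ⟨j, hj, Or.inl ⟨h1, h4 j hj hj1, hj2⟩⟩
      · exact ⟨p.1 - 1, hApred _ hpA (by omega), Or.inr ⟨h1, by omega, by omega⟩⟩
    · exact Or.inl ⟨h1, hb⟩
  have hsep : ∀ x ∈ A, ∀ y ∈ A, ∀ i, x ≤ a i → (∀ j ∈ C, x ≤ j → a i ≤ j) → y ≤ a i →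
      y ≤ x := by
    intro x _ y hy i hx hxC hyi
    by_contra! hlt
    have := hxC (y - 1) (hApred y hy (by omega)) (by omega)
    omega
  have hinj : Set.InjOn e (A ×ˢ range 3 : Finset (ℕ × ℕ)) := by
    intro p hp q hq hpq
    have hp' := Finset.mem_coe.mp hp
    have hq' := Finset.mem_coe.mp hq
    obtain ⟨p1, p2, p3⟩ := he p hp'
    obtain ⟨q1, q2, q3⟩ := he q hq'
    rw [← hpq] at q1 q2 q3
    have hpA := (Finset.mem_product.mp hp').1
    have hqA := (Finset.mem_product.mp hq').1
    exact Prod.ext (le_antisymm (hsep _ hqA _ hpA _ q2 q3 p2) (hsep _ hpA _ hqA _ p2 p3 q2))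
      (p1.symm.trans q1)
  have hcard := Finset.card_le_card_of_injOn e hmaps hinj
  have hU : #(C.biUnion (fun j => upCross a M j ∪ downCross a M j)) ≤ #C * 2 := by
    apply Finset.card_biUnion_le_card_mul
    intro j hj
    have hj1 : #(upCross a M j) = 1 := (mem_filter.mp hj).2
    have := Finset.card_union_le (upCross a M j) (downCross a M j)
    rw [card_downCross w.col_closed] at this
    omega
  have := Finset.card_union_le (changes b M)
    (C.biUnion (fun j => upCross a M j ∪ downCross a M j))
  rw [Finset.card_product, hAcard, Finset.card_range] at hcard
  omega

/-- Two row-changing steps that cross only cuts that are crossed upwards at least three times. -/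
theorem exists_end_changes (w : GridWalk n M a b) (hn : 0 < n) :
    ∃ e₁ ∈ changes b M, ∃ e₂ ∈ changes b M, e₁ ≠ e₂ ∧
      ∀ j < n - 1, #(upCross a M j) ≤ 2 → ∀ e, e = e₁ ∨ e = e₂ →
        e ∉ upCross a M j ∪ downCross a M j := by
  set F := (range (n - 1)).filter fun j => #(upCross a M j) ≤ 2 with hF
  by_cases hne : F.Nonempty
  · have hmin := F.min'_mem hne
    have hmax := F.max'_mem hne
    have hle := F.min'_le _ hmax
    set l := F.min' hne
    set m := F.max' hne
    obtain ⟨hl1, hl2⟩ := mem_filter.mp hmin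
    obtain ⟨hm1, hm2⟩ := mem_filter.mp hmax
    obtain ⟨e₁, he₁, h1, h1'⟩ := w.exists_change_le (Finset.mem_range.mp hl1) hl2
    obtain ⟨e₂, he₂, h2, h2'⟩ := w.exists_change_gt (Finset.mem_range.mp hm1) hm2
    refine ⟨e₁, he₁, e₂, he₂, ?_, ?_⟩
    · rintro rfl
      omega
    · intro j hj hj2 e he
      have hjF : j ∈ F := mem_filter.mpr ⟨Finset.mem_range.mpr hj, hj2⟩
      have := F.min'_le j hjF
      have := F.le_max' j hjF
      simp only [upCross, downCross, Finset.mem_union, mem_filter]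
      rcases he with rfl | rfl <;> omega
  · have h3 := w.card_simpleCuts_add_three_le hn
    obtain ⟨e₁, he₁, e₂, he₂, h12⟩ := Finset.one_lt_card.mp (show 1 < #(changes b M) by omega)
    refine ⟨e₁, he₁, e₂, he₂, h12, fun j hj hj2 => absurd ⟨j, ?_⟩ hne⟩
    exact mem_filter.mpr ⟨Finset.mem_range.mpr hj, hj2⟩

theorem four_mul_le_sum_stepSize (w : GridWalk n M a b) {e₁ e₂ : ℕ}
    (he : ∀ j < n - 1, #(upCross a M j) ≤ 2 → ∀ e, e = e₁ ∨ e = e₂ →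
        e ∉ upCross a M j ∪ downCross a M j) :
    4 * (n - 1) ≤ (∑ i ∈ range M \ {e₁, e₂}, stepSize a i) + 2 * #(simpleCuts a n M) := by
  have hsum : ∑ i ∈ range M \ {e₁, e₂}, stepSize a i =
      ∑ j ∈ range (n - 1), #((upCross a M j ∪ downCross a M j) \ {e₁, e₂}) := by
    rw [Finset.sum_congr rfl fun i _ => stepSize_eq_sum w.col_lt i, Finset.sum_comm]
    refine Finset.sum_congr rfl fun j _ => ?_
    rw [← Finset.card_filter]
    congr 1
    ext i
    simp only [upCross, downCross, mem_filter, Finset.mem_sdiff, Finset.mem_union]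
    tauto
  rw [hsum, simpleCuts, Finset.card_filter, Finset.mul_sum, ← Finset.sum_add_distrib]
  have hconst : 4 * (n - 1) = ∑ _j ∈ range (n - 1), 4 := by
    rw [Finset.sum_const, Finset.card_range, smul_eq_mul, mul_comm]
  rw [hconst]
  refine Finset.sum_le_sum fun j hj => ?_
  have hj := Finset.mem_range.mp hj
  have h1 := w.one_le_card_upCross hj
  have hU : #(upCross a M j ∪ downCross a M j) = 2 * #(upCross a M j) := by
    rw [Finset.card_union_of_disjoint (disjoint_upCross_downCross a M j),
      card_downCross w.col_closed, two_mul]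
  by_cases h2 : #(upCross a M j) ≤ 2
  · have hd : Disjoint (upCross a M j ∪ downCross a M j) {e₁, e₂} := by
      rw [Finset.disjoint_right]
      intro e hmem
      exact he j hj h2 e (by simpa using hmem)
    rw [Finset.sdiff_eq_self_of_disjoint hd, hU]
    split_ifs <;> omega
  · have := Finset.le_card_sdiff ({e₁, e₂} : Finset ℕ) (upCross a M j ∪ downCross a M j)
    have := Finset.card_le_two (a := e₁) (b := e₂)
    split_ifs <;> omega

end GridWalk

/-- Linear lower bound for the length of a closed grid walk without stationary steps, for a unit
vector `(α, β)`. -/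
theorem GridWalk.le_sum_sqrt {n M : ℕ} {a b : ℕ → ℕ} (w : GridWalk n M a b) (hn : 0 < n)
    (hne : ∀ i < M, b i = b (i + 1) → a i ≠ a (i + 1)) {d α β : ℝ} (hd : 0 ≤ d) (hα : 0 ≤ α)
    (hβ : 0 ≤ β) (hαβ : α ^ 2 + β ^ 2 = 1) :
    (1 - α) * (M - #(changes b M)) + α * (4 * ((n : ℝ) - 1) - 2 * #(simpleCuts a n M)) +
        β * d * (∑ i ∈ range M, (stepSize b i : ℝ)) + 2 * ((1 - β) * d) ≤
      ∑ i ∈ range M, √((stepSize a i : ℝ) ^ 2 + (stepSize b i * d) ^ 2) := by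
  have hα1 : α ≤ 1 := by nlinarith
  have hβ1 : β ≤ 1 := by nlinarith
  obtain ⟨e₁, he₁, e₂, he₂, h12, hcross⟩ := w.exists_end_changes hn
  have hH := w.four_mul_le_sum_stepSize hcross
  have hpt : ∀ i ∈ range M,
      (1 - α) * (if b i ≠ b (i + 1) then 0 else 1) +
      α * (if i ∈ ({e₁, e₂} : Finset ℕ) then 0 else (stepSize a i : ℝ)) +
      β * d * stepSize b i + (1 - β) * d * (if i ∈ ({e₁, e₂} : Finset ℕ) then 1 else 0) ≤
      √((stepSize a i : ℝ) ^ 2 + (stepSize b i * d) ^ 2) := by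
    intro i hi
    have hx : (0 : ℝ) ≤ stepSize a i := Nat.cast_nonneg _
    have hy : (0 : ℝ) ≤ stepSize b i * d := mul_nonneg (Nat.cast_nonneg _) hd
    by_cases hb : b i = b (i + 1)
    · have hnot : i ∉ ({e₁, e₂} : Finset ℕ) := by
        simp only [Finset.mem_insert, Finset.mem_singleton]
        rintro (rfl | rfl)
        · exact (mem_filter.mp he₁).2 hb
        · exact (mem_filter.mp he₂).2 hb
      have hs : stepSize b i = 0 := by simp only [stepSize]; omega
      have hs' : (1 : ℝ) ≤ stepSize a i := by
        have := hne i (Finset.mem_range.mp hi) hb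
        have : 1 ≤ stepSize a i := by simp only [stepSize]; omega
        exact_mod_cast this
      rw [if_neg (not_not.mpr hb), if_neg hnot, if_neg hnot, hs, Nat.cast_zero, zero_mul,
        zero_pow two_ne_zero, add_zero, Real.sqrt_sq hx]
      nlinarith
    · rw [if_pos hb]
      by_cases hmem : i ∈ ({e₁, e₂} : Finset ℕ)
      · have hs : (1 : ℝ) ≤ stepSize b i := by
          have : 1 ≤ stepSize b i := by simp only [stepSize]; omega
          exact_mod_cast this
        rw [if_pos hmem, if_pos hmem]
        have h1 : (stepSize b i : ℝ) * d ≤ √((stepSize a i : ℝ) ^ 2 + (stepSize b i * d) ^ 2) :=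
          Real.le_sqrt_of_sq_le (by nlinarith)
        have h2 : 0 ≤ (1 - β) * d * (stepSize b i - 1) :=
          mul_nonneg (mul_nonneg (by linarith) hd) (by linarith)
        nlinarith
      · rw [if_neg hmem, if_neg hmem]
        apply Real.le_sqrt_of_sq_le
        nlinarith [sq_nonneg (α * (stepSize b i * d) - β * stepSize a i)]
  have hsum := Finset.sum_le_sum hpt
  simp only [Finset.sum_add_distrib, ← Finset.mul_sum] at hsum
  have hsub : ({e₁, e₂} : Finset ℕ) ⊆ range M := by
    intro i hi
    simp only [Finset.mem_insert, Finset.mem_singleton] at hi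
    rcases hi with rfl | rfl
    · exact (mem_filter.mp he₁).1
    · exact (mem_filter.mp he₂).1
  have hS1 : ∑ i ∈ range M, (if b i ≠ b (i + 1) then (0 : ℝ) else 1) = M - #(changes b M) := by
    have : ∀ i ∈ range M, (if b i ≠ b (i + 1) then (0 : ℝ) else 1) =
        1 - (if b i ≠ b (i + 1) then 1 else 0) := by
      intro i _
      split_ifs <;> norm_num
    rw [Finset.sum_congr rfl this, Finset.sum_sub_distrib, Finset.sum_boole, changes]
    simp
  have hS2 : ∑ i ∈ range M, (if i ∈ ({e₁, e₂} : Finset ℕ) then 0 else (stepSize a i : ℝ)) =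
      ((∑ i ∈ range M \ {e₁, e₂}, stepSize a i : ℕ) : ℝ) := by
    push_cast
    rw [← Finset.filter_notMem_eq_sdiff, Finset.sum_filter]
    exact Finset.sum_congr rfl fun i _ => by split_ifs <;> simp_all
  have hS3 : ∑ i ∈ range M, (if i ∈ ({e₁, e₂} : Finset ℕ) then (1 : ℝ) else 0) = 2 := by
    rw [Finset.sum_ite_mem, Finset.inter_eq_right.mpr hsub, Finset.sum_const,
      Finset.card_pair h12]
    norm_num
  rw [hS1, hS2, hS3] at hsum
  have hH' : 4 * ((n : ℝ) - 1) - 2 * #(simpleCuts a n M) ≤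
      ((∑ i ∈ range M \ {e₁, e₂}, stepSize a i : ℕ) : ℝ) := by
    have : 4 * n ≤ (∑ i ∈ range M \ {e₁, e₂}, stepSize a i) + 2 * #(simpleCuts a n M) + 4 := by
      omega
    have : (4 * n : ℝ) ≤ ((∑ i ∈ range M \ {e₁, e₂}, stepSize a i : ℕ) : ℝ) +
        2 * #(simpleCuts a n M) + 4 := by exact_mod_cast this
    linarith
  have := mul_le_mul_of_nonneg_left hH' hα
  linarith

theorem two_mul_mul_zcost (d x : ℝ) {y : ℝ} (hy : 0 < y) :
    y * zcost d (x / y) = 2 * (x - y) + √((x - y) ^ 2 + (y * d) ^ 2) := by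
  have h : (x - y) ^ 2 + (y * d) ^ 2 = y ^ 2 * ((x / y - 1) ^ 2 + d ^ 2) := by
    field_simp
  rw [h, Real.sqrt_mul (sq_nonneg y), Real.sqrt_sq hy.le, zcost]
  field_simp

theorem IsTour.gridWalk {n : ℕ} {t : ℕ → Fin n × Fin 3} (ht : IsTour n t) :
    GridWalk n (3 * n) (fun i => (t i).1) (fun i => (t i).2) where
  col_lt i := (t i).1.2
  row_lt i := (t i).2.2
  surj x hx y hy := by
    obtain ⟨i, hi⟩ := ht.1.2 (⟨x, hx⟩, ⟨y, hy⟩)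
    exact ⟨i, i.2, by simp only at hi; simp [hi], by simp only at hi; simp [hi]⟩
  col_closed := by simp only [ht.2]
  row_closed := by simp only [ht.2]

theorem IsTour.ne_succ {n : ℕ} {t : ℕ → Fin n × Fin 3} (ht : IsTour n t) {i : ℕ}
    (hi : i < 3 * n) : t i ≠ t (i + 1) := by
  intro h
  by_cases hlt : i + 1 < 3 * n
  · have := @ht.1.1 ⟨i, hi⟩ ⟨i + 1, hlt⟩ h
    simp at this
  · rw [show i + 1 = 3 * n by omega, ht.2] at h
    have := @ht.1.1 ⟨i, hi⟩ ⟨0, by omega⟩ h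
    simp only [Fin.mk.injEq] at this
    omega

theorem eucl_pt_eq_sqrt_stepSize (n : ℕ) (d : ℝ) (t : ℕ → Fin n × Fin 3) (i : ℕ) :
    eucl (pt n d (t i)) (pt n d (t (i + 1))) =
      √((stepSize (fun i => (t i).1) i : ℝ) ^ 2 + (stepSize (fun i => (t i).2) i * d) ^ 2) := by
  rw [eucl, mul_pow]
  simp only [stepSize, Nat.cast_natAbs, Int.cast_abs, sq_abs, pt]
  push_cast
  congr 1
  ring

/-- For `d ≥ 4` and even `n ≥ 3`, every TSP tour of `G(n,d)` has length at
least the minimum over integers `1 ≤ k ≤ n/2` of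
`n + 2k + 2d − 2 + 2k·c(n/(2k))` where `c(x) = 2(x−1) + √((x−1)² + d²)`. -/
theorem statement11 (n : ℕ) (hn : 3 ≤ n) (hne : Even n) (d : ℝ) (hd : 4 ≤ d)
    (t : ℕ → Fin n × Fin 3) (ht : IsTour n t) :
    sInf {v : ℝ | ∃ k : ℕ, 1 ≤ k ∧ k ≤ n / 2 ∧
        v = (n : ℝ) + 2 * k + 2 * d - 2 + 2 * k * zcost d ((n : ℝ) / (2 * k))} ≤
      tourLength n d t := by
  set a : ℕ → ℕ := fun i => (t i).1 with ha
  set b : ℕ → ℕ := fun i => (t i).2 with hb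
  have w : GridWalk n (3 * n) a b := ht.gridWalk
  have hlen : tourLength n d t =
      ∑ i ∈ range (3 * n), √((stepSize a i : ℝ) ^ 2 + (stepSize b i * d) ^ 2) :=
    Finset.sum_congr rfl fun i _ => eucl_pt_eq_sqrt_stepSize n d t i
  have hst : ∀ i < 3 * n, b i = b (i + 1) → a i ≠ a (i + 1) := fun i hi hbi hai =>
    ht.ne_succ hi (Prod.ext (Fin.ext hai) (Fin.ext hbi))
  have hcuts := w.card_simpleCuts_add_three_le (by omega)
  have hNW := card_changes_le b (3 * n)
  obtain ⟨m, hm⟩ := even_sum_stepSize w.row_closed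
  obtain ⟨k, rfl⟩ : ∃ k, m = k + 1 := ⟨m - 1, by omega⟩
  have hk1 : 1 ≤ k := by omega
  have hW : ∑ i ∈ range (3 * n), (stepSize b i : ℝ) = 2 * k + 2 := by
    rw [← Nat.cast_sum, hm]
    push_cast
    ring
  have hN : (#(changes b (3 * n)) : ℝ) ≤ 2 * k + 2 := by
    rw [← hW]
    exact_mod_cast hNW
  have hc : (#(simpleCuts a n (3 * n)) : ℝ) ≤ 2 * k - 1 := by
    have : #(simpleCuts a n (3 * n)) + 1 ≤ 2 * k := by omega
    have : (#(simpleCuts a n (3 * n)) : ℝ) + 1 ≤ 2 * k := by exact_mod_cast this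
    linarith
  have hbdd : BddBelow {v : ℝ | ∃ k : ℕ, 1 ≤ k ∧ k ≤ n / 2 ∧
        v = (n : ℝ) + 2 * k + 2 * d - 2 + 2 * k * zcost d ((n : ℝ) / (2 * k))} := by
    apply Set.Finite.bddBelow
    refine ((Finset.Icc 1 (n / 2)).finite_toSet.image fun k : ℕ =>
      (n : ℝ) + 2 * k + 2 * d - 2 + 2 * k * zcost d ((n : ℝ) / (2 * k))).subset ?_
    rintro v ⟨k, h1, h2, rfl⟩
    exact ⟨k, by simp [h1, h2], rfl⟩
  rw [hlen]
  by_cases hkn : k ≤ n / 2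
  · refine (csInf_le hbdd ⟨k, hk1, hkn, rfl⟩).trans ?_
    have hk0 : (0 : ℝ) < 2 * k := by positivity
    have hx : 0 ≤ (n : ℝ) - 2 * k := by
      have : 2 * k ≤ n := by omega
      have : (2 * k : ℝ) ≤ n := by exact_mod_cast this
      linarith
    rw [two_mul_mul_zcost d n hk0]
    set x := (n : ℝ) - 2 * k with hxdef
    set y := 2 * (k : ℝ) * d with hydef
    have hy : 0 < y := mul_pos hk0 (by linarith)
    set R := √(x ^ 2 + y ^ 2) with hR
    have hRpos : 0 < R := Real.sqrt_pos.mpr (by positivity)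
    have hRsq : R ^ 2 = x ^ 2 + y ^ 2 := Real.sq_sqrt (by positivity)
    have hα0 : 0 ≤ x / R := by positivity
    have hα1 : x / R ≤ 1 := by
      rw [div_le_one hRpos]
      exact Real.le_sqrt_of_sq_le (by nlinarith)
    have hαβ : (x / R) ^ 2 + (y / R) ^ 2 = 1 := by
      rw [div_pow, div_pow, ← add_div, ← hRsq, div_self (by positivity)]
    have hdot : x / R * x + y / R * y = R := by
      field_simp
      linarith
    have key := w.le_sum_sqrt (by omega) hst (by linarith : 0 ≤ d) hα0
      (by positivity : 0 ≤ y / R) hαβ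
    refine le_trans ?_ key
    rw [hW]
    generalize x / R = α at *
    generalize y / R = β at *
    have e1 := mul_le_mul_of_nonneg_left hN (sub_nonneg.mpr hα1)
    have e2 := mul_le_mul_of_nonneg_left hc hα0
    have e3 : α * x = α * n - 2 * (α * k) := by rw [hxdef]; ring
    have e4 : β * y = 2 * (β * d * k) := by rw [hydef]; ring
    push_cast
    linarith
  · have hn2 : 2 * (n / 2) = n := Nat.two_mul_div_two_of_even hne
    refine (csInf_le hbdd ⟨n / 2, by omega, le_rfl, rfl⟩).trans ?_
    have hn2' : (2 : ℝ) * ((n / 2 : ℕ) : ℝ) = n := by exact_mod_cast hn2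
    have hn0 : (0 : ℝ) < n := by
      have : 0 < n := by omega
      exact_mod_cast this
    rw [hn2', two_mul_mul_zcost d n hn0, sub_self, zero_pow two_ne_zero, zero_add,
      Real.sqrt_sq (by nlinarith)]
    have key := w.le_sum_sqrt (α := 0) (β := 1) (by omega) hst (by linarith : 0 ≤ d) le_rfl
      zero_le_one (by norm_num)
    rw [hW] at key
    have hkn' : (n : ℝ) + 2 ≤ 2 * k := by
      have : n + 2 ≤ 2 * k := by omega
      exact_mod_cast this
    have : 0 ≤ (d - 1) * (2 * k - (n + 2)) := mul_nonneg (by linarith) (by linarith)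
    push_cast at key
    nlinarith

end
end
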